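/- arXiv:2301.00579 — 10 statements merged into one kernel-verified Lean document; each statement's English description precedes it below -/
import Mathlib

section
/- Let (V, R, T, 𝔤) be a generalized symmetric holonomy system. Then the bracket on 𝔍 = 𝔤 ⊕ V defined by [(A,x),(A′,y)] = ([A,A′] − R(x,y), A(y) − A′(x) − T(x,y)) satisfies the Jacobi identity: [[u,v],w] + [[v,w],u] + [[w,u],v] = 0 for all u, v, w ∈ 𝔍. In particular, 𝔍 with this bracket is a real Lie algebra. -/
open RealInnerProductSpace

/-- The bracket on 𝔍 = 𝔤 ⊕ V for a generalized symmetric holonomy system: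
`[(A,x),(A′,y)] = ([A,A′] − R(x,y), A(y) − A′(x) − T(x,y))`. -/
def brkJ {V : Type} [NormedAddCommGroup V] [InnerProductSpace ℝ V]
    (g : Submodule ℝ (V →ₗ[ℝ] V))
    (hg : ∀ A ∈ g, ∀ B ∈ g, A ∘ₗ B - B ∘ₗ A ∈ g)
    (R : V →ₗ[ℝ] V →ₗ[ℝ] (V →ₗ[ℝ] V)) (hR : ∀ x y : V, R x y ∈ g)
    (T : V →ₗ[ℝ] V →ₗ[ℝ] V) :
    (↥g × V) → (↥g × V) → (↥g × V) :=
  fun u v =>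
    (⟨u.1.1 ∘ₗ v.1.1 - v.1.1 ∘ₗ u.1.1 - R u.2 v.2,
      sub_mem (hg _ u.1.2 _ v.1.2) (hR u.2 v.2)⟩,
     u.1.1 v.2 - v.1.1 u.2 - T u.2 v.2)

/-- For a generalized symmetric holonomy system `(V, R, T, 𝔤)`, the bracket on
`𝔍 = 𝔤 ⊕ V` satisfies the Jacobi identity; in particular `𝔍` is a real Lie algebra. -/
theorem jacobi_of_gen_sym_holonomy_system
    {V : Type} [NormedAddCommGroup V] [InnerProductSpace ℝ V]
    [FiniteDimensional ℝ V] [Nontrivial V]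
    (g : Submodule ℝ (V →ₗ[ℝ] V))
    (hg_lie : ∀ A ∈ g, ∀ B ∈ g, A ∘ₗ B - B ∘ₗ A ∈ g)
    (hg_skew : ∀ A ∈ g, ∀ x y : V, ⟪A x, y⟫ = -⟪x, A y⟫)
    (R : V →ₗ[ℝ] V →ₗ[ℝ] (V →ₗ[ℝ] V)) (hRg : ∀ x y : V, R x y ∈ g)
    (hRalt : ∀ x : V, R x x = 0)
    (T : V →ₗ[ℝ] V →ₗ[ℝ] V) (hTalt : ∀ x : V, T x x = 0)
    (hB1 : ∀ x y z : V,
      R x y z + T x (T y z) + R y z x + T y (T z x) + R z x y + T z (T x y) = 0)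
    (hB2 : ∀ x y z : V, R x (T y z) + R y (T z x) + R z (T x y) = 0)
    (hS1 : ∀ A ∈ g, ∀ x y : V,
      A ∘ₗ R x y - R x y ∘ₗ A = R (A x) y + R x (A y))
    (hS2 : ∀ A ∈ g, ∀ x y : V, A (T x y) = T (A x) y + T x (A y)) :
    ∀ u v w : ↥g × V,
      brkJ g hg_lie R hRg T (brkJ g hg_lie R hRg T u v) w
        + brkJ g hg_lie R hRg T (brkJ g hg_lie R hRg T v w) u
        + brkJ g hg_lie R hRg T (brkJ g hg_lie R hRg T w u) v = 0 := by
  have hRanti : ∀ x y : V, R x y = -R y x := fun x y => (LinearMap.IsAlt.neg hRalt y x).symm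
  have hTanti : ∀ x y : V, T x y = -T y x := fun x y => (LinearMap.IsAlt.neg hTalt y x).symm
  rintro ⟨⟨A, hA⟩, x⟩ ⟨⟨B, hB⟩, y⟩ ⟨⟨C, hC⟩, z⟩
  refine Prod.ext (Subtype.ext (LinearMap.ext fun v => ?_)) ?_
  · have hA' := LinearMap.congr_fun (hS1 A hA y z) v
    have hB' := LinearMap.congr_fun (hS1 B hB z x) v
    have hC' := LinearMap.congr_fun (hS1 C hC x y) v
    have h2 := LinearMap.congr_fun (hB2 x y z) v
    rw [hRanti y (A z)] at hA'
    rw [hRanti z (B x)] at hB'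
    rw [hRanti x (C y)] at hC'
    rw [hRanti x, hRanti y, hRanti z] at h2
    simp only [brkJ, Prod.fst_add, Prod.fst_zero, Submodule.coe_add, Submodule.coe_zero,
      LinearMap.add_apply, LinearMap.sub_apply, LinearMap.neg_apply, LinearMap.comp_apply,
      LinearMap.zero_apply, map_sub] at hA' hB' hC' h2 ⊢
    linear_combination (norm := module) hA' + hB' + hC' - h2
  · have hA' := hS2 A hA y z
    have hB' := hS2 B hB z x
    have hC' := hS2 C hC x y
    have h1 := hB1 x y z
    rw [hTanti y (A z)] at hA'
    rw [hTanti z (B x)] at hB'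
    rw [hTanti x (C y)] at hC'
    rw [hTanti x (T y z), hTanti y (T z x), hTanti z (T x y)] at h1
    simp only [brkJ, Prod.snd_add, Prod.snd_zero,
      LinearMap.sub_apply, LinearMap.comp_apply, map_sub]
    linear_combination (norm := module) hA' + hB' + hC' - h1
end

section
/- Let (V, R, T, 𝔤) be a generalized symmetric holonomy system. Then for every C₁, C₂ ∈ 𝔤 one has B′(C₁,C₂) = κ(C₁,C₂) + tr(C₁ ∘ C₂), where the last trace is taken over V. Moreover the restriction of B′ to 𝔤 is negative definite: B′(C,C) < 0 for every nonzero C ∈ 𝔤. -/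
open RealInnerProductSpace

/-- `ad_u : 𝔍 → 𝔍`, as a linear map. -/
def adJ {V : Type} [NormedAddCommGroup V] [InnerProductSpace ℝ V]
    (g : Submodule ℝ (V →ₗ[ℝ] V))
    (hg : ∀ A ∈ g, ∀ B ∈ g, A ∘ₗ B - B ∘ₗ A ∈ g)
    (R : V →ₗ[ℝ] V →ₗ[ℝ] (V →ₗ[ℝ] V)) (hR : ∀ x y : V, R x y ∈ g)
    (T : V →ₗ[ℝ] V →ₗ[ℝ] V) (u : ↥g × V) :
    (↥g × V) →ₗ[ℝ] (↥g × V) where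
  toFun v := brkJ g hg R hR T u v
  map_add' v w := by
    refine Prod.ext (Subtype.ext ?_) ?_ <;>
      simp [brkJ, LinearMap.comp_add, LinearMap.add_comp] <;> abel
  map_smul' c v := by
    refine Prod.ext (Subtype.ext ?_) ?_ <;>
      simp [brkJ, LinearMap.comp_smul, LinearMap.smul_comp, smul_sub] <;> abel

/-- The form `B′(u,v) = tr(ad_u ∘ ad_v)` on 𝔍. -/
noncomputable def Bform {V : Type} [NormedAddCommGroup V] [InnerProductSpace ℝ V]
    (g : Submodule ℝ (V →ₗ[ℝ] V))
    (hg : ∀ A ∈ g, ∀ B ∈ g, A ∘ₗ B - B ∘ₗ A ∈ g)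
    (R : V →ₗ[ℝ] V →ₗ[ℝ] (V →ₗ[ℝ] V)) (hR : ∀ x y : V, R x y ∈ g)
    (T : V →ₗ[ℝ] V →ₗ[ℝ] V) (u v : ↥g × V) : ℝ :=
  LinearMap.trace ℝ (↥g × V) (adJ g hg R hR T u ∘ₗ adJ g hg R hR T v)

/-- `ad` within 𝔤. -/
def adg {V : Type} [NormedAddCommGroup V] [InnerProductSpace ℝ V]
    (g : Submodule ℝ (V →ₗ[ℝ] V))
    (hg : ∀ A ∈ g, ∀ B ∈ g, A ∘ₗ B - B ∘ₗ A ∈ g)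
    (A : ↥g) : ↥g →ₗ[ℝ] ↥g where
  toFun B := ⟨A.1 ∘ₗ B.1 - B.1 ∘ₗ A.1, hg _ A.2 _ B.2⟩
  map_add' B C := by
    refine Subtype.ext ?_
    simp [LinearMap.comp_add, LinearMap.add_comp]
    abel
  map_smul' c B := by
    refine Subtype.ext ?_
    simp [LinearMap.comp_smul, LinearMap.smul_comp, smul_sub]

/-- The Killing form `κ` of the Lie algebra 𝔤. -/
noncomputable def killing {V : Type} [NormedAddCommGroup V] [InnerProductSpace ℝ V]
    (g : Submodule ℝ (V →ₗ[ℝ] V))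
    (hg : ∀ A ∈ g, ∀ B ∈ g, A ∘ₗ B - B ∘ₗ A ∈ g)
    (A B : ↥g) : ℝ :=
  LinearMap.trace ℝ ↥g (adg g hg A ∘ₗ adg g hg B)

/-- A nonzero skew-adjoint endomorphism has square of negative trace. -/
lemma trace_comp_self_neg_of_skew {W : Type*} [NormedAddCommGroup W] [InnerProductSpace ℝ W]
    [FiniteDimensional ℝ W] (A : W →ₗ[ℝ] W) (hA : ∀ x y : W, ⟪A x, y⟫ = -⟪x, A y⟫)
    (h0 : A ≠ 0) : LinearMap.trace ℝ W (A ∘ₗ A) < 0 := by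
  have key : ∀ x : W, ⟪x, (A ∘ₗ A) x⟫ = -‖A x‖ ^ 2 := fun x => by
    rw [LinearMap.comp_apply, ← real_inner_self_eq_norm_sq, hA x (A x), neg_neg]
  rw [LinearMap.trace_eq_sum_inner _ (stdOrthonormalBasis ℝ W)]
  simp_rw [key, Finset.sum_neg_distrib]
  refine neg_neg_of_pos (Finset.sum_pos' (fun _ _ => by positivity) ?_)
  by_contra! h
  refine h0 ((stdOrthonormalBasis ℝ W).toBasis.ext fun i => ?_)
  have hi := h i (Finset.mem_univ i)
  simpa using le_antisymm hi (by positivity)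

lemma trace_comp_self_nonpos_of_skew {W : Type*} [NormedAddCommGroup W] [InnerProductSpace ℝ W]
    [FiniteDimensional ℝ W] (A : W →ₗ[ℝ] W) (hA : ∀ x y : W, ⟪A x, y⟫ = -⟪x, A y⟫) :
    LinearMap.trace ℝ W (A ∘ₗ A) ≤ 0 := by
  obtain rfl | h0 := eq_or_ne A 0
  · simp
  · exact (trace_comp_self_neg_of_skew A hA h0).le

/-- On a space of skew-adjoint endomorphisms, `-tr(A ∘ B)` is an inner product. -/
@[reducible]
noncomputable def skewTraceCore {V : Type*} [NormedAddCommGroup V] [InnerProductSpace ℝ V]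
    [FiniteDimensional ℝ V] (g : Submodule ℝ (V →ₗ[ℝ] V))
    (hg_skew : ∀ A ∈ g, ∀ x y : V, ⟪A x, y⟫ = -⟪x, A y⟫) :
    InnerProductSpace.Core ℝ ↥g where
  inner A B := -LinearMap.trace ℝ V (A.1 ∘ₗ B.1)
  conj_inner_symm A B := congrArg Neg.neg (LinearMap.trace_mul_comm ℝ B.1 A.1)
  re_inner_nonneg A :=
    neg_nonneg.2 (trace_comp_self_nonpos_of_skew A.1 (hg_skew A.1 A.2))
  add_left A B C := by
    simp [LinearMap.add_comp, add_comm]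
  smul_left A B r := by
    simp [LinearMap.smul_comp]
  definite A h := by
    by_contra h0
    exact (trace_comp_self_neg_of_skew A.1 (hg_skew A.1 A.2)
      fun h' => h0 (Subtype.ext h')).ne (neg_eq_zero.1 h)

/-- The Killing form of a Lie algebra of skew-adjoint endomorphisms is negative semidefinite. -/
lemma killing_self_nonpos {V : Type} [NormedAddCommGroup V] [InnerProductSpace ℝ V]
    [FiniteDimensional ℝ V] (g : Submodule ℝ (V →ₗ[ℝ] V))
    (hg : ∀ A ∈ g, ∀ B ∈ g, A ∘ₗ B - B ∘ₗ A ∈ g)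
    (hg_skew : ∀ A ∈ g, ∀ x y : V, ⟪A x, y⟫ = -⟪x, A y⟫) (C : ↥g) :
    killing g hg C C ≤ 0 := by
  let _ : NormedAddCommGroup ↥g := (skewTraceCore g hg_skew).toNormedAddCommGroup
  let _ : InnerProductSpace ℝ ↥g := InnerProductSpace.ofCore (skewTraceCore g hg_skew).toCore
  refine trace_comp_self_nonpos_of_skew (adg g hg C) fun A B => ?_
  change -LinearMap.trace ℝ V ((C.1 * A.1 - A.1 * C.1) * B.1)
    = - -LinearMap.trace ℝ V (A.1 * (C.1 * B.1 - B.1 * C.1))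
  rw [sub_mul, mul_sub, map_sub, map_sub, ← mul_assoc, ← mul_assoc,
    LinearMap.trace_mul_cycle ℝ A.1 B.1 C.1]
  ring

lemma adJ_of_mem {V : Type} [NormedAddCommGroup V] [InnerProductSpace ℝ V]
    (g : Submodule ℝ (V →ₗ[ℝ] V))
    (hg : ∀ A ∈ g, ∀ B ∈ g, A ∘ₗ B - B ∘ₗ A ∈ g)
    (R : V →ₗ[ℝ] V →ₗ[ℝ] (V →ₗ[ℝ] V)) (hR : ∀ x y : V, R x y ∈ g)
    (T : V →ₗ[ℝ] V →ₗ[ℝ] V) (C : ↥g) :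
    adJ g hg R hR T (C, 0) = (adg g hg C).prodMap C.1 := by
  refine LinearMap.ext fun v => Prod.ext (Subtype.ext ?_) ?_ <;> simp [adJ, brkJ, adg]

/-- For a generalized symmetric holonomy system, `B′(C₁,C₂) = κ(C₁,C₂) + tr(C₁ ∘ C₂)`
on 𝔤, and the restriction of `B′` to 𝔤 is negative definite. -/
theorem Bform_restrict_g_eq_killing_add_trace_and_negDef
    {V : Type} [NormedAddCommGroup V] [InnerProductSpace ℝ V]
    [FiniteDimensional ℝ V] [Nontrivial V]
    (g : Submodule ℝ (V →ₗ[ℝ] V))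
    (hg_lie : ∀ A ∈ g, ∀ B ∈ g, A ∘ₗ B - B ∘ₗ A ∈ g)
    (hg_skew : ∀ A ∈ g, ∀ x y : V, ⟪A x, y⟫ = -⟪x, A y⟫)
    (R : V →ₗ[ℝ] V →ₗ[ℝ] (V →ₗ[ℝ] V)) (hRg : ∀ x y : V, R x y ∈ g)
    (hRalt : ∀ x : V, R x x = 0)
    (T : V →ₗ[ℝ] V →ₗ[ℝ] V) (hTalt : ∀ x : V, T x x = 0)
    (hB1 : ∀ x y z : V,
      R x y z + T x (T y z) + R y z x + T y (T z x) + R z x y + T z (T x y) = 0)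
    (hB2 : ∀ x y z : V, R x (T y z) + R y (T z x) + R z (T x y) = 0)
    (hS1 : ∀ A ∈ g, ∀ x y : V,
      A ∘ₗ R x y - R x y ∘ₗ A = R (A x) y + R x (A y))
    (hS2 : ∀ A ∈ g, ∀ x y : V, A (T x y) = T (A x) y + T x (A y)) :
    (∀ C₁ C₂ : ↥g,
      Bform g hg_lie R hRg T (C₁, 0) (C₂, 0)
        = killing g hg_lie C₁ C₂ + LinearMap.trace ℝ V (C₁.1 ∘ₗ C₂.1))
    ∧ (∀ C : ↥g, C ≠ 0 → Bform g hg_lie R hRg T (C, 0) (C, 0) < 0) := by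
  have key : ∀ C₁ C₂ : ↥g,
      Bform g hg_lie R hRg T (C₁, 0) (C₂, 0)
        = killing g hg_lie C₁ C₂ + LinearMap.trace ℝ V (C₁.1 ∘ₗ C₂.1) := fun C₁ C₂ => by
    rw [Bform, adJ_of_mem, adJ_of_mem, LinearMap.prodMap_comp, LinearMap.trace_prodMap', killing]
  refine ⟨key, fun C hC => ?_⟩
  rw [key]
  exact add_neg_of_nonpos_of_neg (killing_self_nonpos g hg_lie hg_skew C)
    (trace_comp_self_neg_of_skew C.1 (hg_skew C.1 C.2) fun h => hC (Subtype.ext h))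
end

section
/- Let (V, R, T, 𝔤) be an irreducible generalized symmetric holonomy system. Then there exists a real number λ such that B′(x,y) = λ⟨x,y⟩ for all x, y ∈ V. -/
open RealInnerProductSpace

/-- The trace form on endomorphisms is invariant under commutators. -/
theorem trace_commutator_mul {K M : Type*} [CommRing K] [AddCommGroup M] [Module K M]
    (a x y : Module.End K M) :
    LinearMap.trace K M ((a * x - x * a) * y) =
      -LinearMap.trace K M (x * (a * y - y * a)) := by
  rw [sub_mul, mul_sub, map_sub, map_sub, mul_assoc, LinearMap.trace_mul_comm K a, mul_assoc,
    mul_assoc, neg_sub]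

/-- An irreducible Lie algebra of skew-adjoint operators preserves only one symmetric bilinear
form up to scaling. -/
theorem exists_eq_smul_inner_of_invariant
    {V : Type*} [NormedAddCommGroup V] [InnerProductSpace ℝ V]
    [FiniteDimensional ℝ V] [Nontrivial V]
    (g : Submodule ℝ (V →ₗ[ℝ] V))
    (hskew : ∀ A ∈ g, ∀ x y : V, ⟪A x, y⟫ = -⟪x, A y⟫)
    (hirr : ∀ W : Submodule ℝ V, (∀ A ∈ g, ∀ w ∈ W, A w ∈ W) → W = ⊥ ∨ W = ⊤)
    (b : V →ₗ[ℝ] V →ₗ[ℝ] ℝ) (hsymm : ∀ x y, b x y = b y x)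
    (hinv : ∀ A ∈ g, ∀ x y, b (A x) y = -b x (A y)) :
    ∃ c : ℝ, ∀ x y, b x y = c * ⟪x, y⟫ := by
  obtain ⟨S, hS⟩ : ∃ S : V →ₗ[ℝ] V, ∀ x y, ⟪S x, y⟫ = b x y := by
    refine ⟨(InnerProductSpace.toDual ℝ V).symm.toLinearEquiv.toLinearMap ∘ₗ
      LinearMap.toContinuousLinearMap.toLinearMap ∘ₗ b, fun x y => ?_⟩
    simp
  have hSsymm : S.IsSymmetric := fun x y => by
    rw [hS, real_inner_comm, hS, hsymm]
  have hcomm : ∀ A ∈ g, ∀ x, S (A x) = A (S x) := fun A hA x =>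
    ext_inner_right ℝ fun y => by rw [hS, hinv A hA, hskew A hA, hS]
  obtain ⟨c, hc⟩ : ∃ c, Module.End.HasEigenvalue S c :=
    ⟨_, hSsymm.hasEigenvalue_iSup_of_finiteDimensional⟩
  have htop : Module.End.eigenspace S c = ⊤ := by
    refine (hirr _ fun A hA w hw => ?_).resolve_left hc
    rw [Module.End.mem_eigenspace_iff] at hw ⊢
    rw [hcomm A hA, hw, map_smul]
  refine ⟨c, fun x y => ?_⟩
  have hx : S x = c • x := Module.End.mem_eigenspace_iff.1 (htop ▸ Submodule.mem_top)
  rw [← hS, hx, real_inner_smul_left]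

section

variable {V : Type} [NormedAddCommGroup V] [InnerProductSpace ℝ V]
  (g : Submodule ℝ (V →ₗ[ℝ] V))
  (hg : ∀ A ∈ g, ∀ B ∈ g, A ∘ₗ B - B ∘ₗ A ∈ g)
  (R : V →ₗ[ℝ] V →ₗ[ℝ] (V →ₗ[ℝ] V)) (hR : ∀ x y : V, R x y ∈ g)
  (T : V →ₗ[ℝ] V →ₗ[ℝ] V)

/-- The map `x ↦ ad_x` on `V`, bundled as a linear map. -/
def adJV : V →ₗ[ℝ] Module.End ℝ (↥g × V) where
  toFun x := adJ g hg R hR T (0, x)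
  map_add' x y := by
    refine LinearMap.ext fun w => Prod.ext (Subtype.ext ?_) ?_ <;>
      simp [adJ, brkJ] <;> abel
  map_smul' c x := by
    refine LinearMap.ext fun w => Prod.ext (Subtype.ext ?_) ?_ <;>
      simp [adJ, brkJ, smul_sub]

/-- `ad_{A x} = [ad_A, ad_x]` for `A ∈ 𝔤` and `x ∈ V`. -/
theorem adJV_apply_eq_commutator
    (hS1 : ∀ A ∈ g, ∀ x y : V,
      A ∘ₗ R x y - R x y ∘ₗ A = R (A x) y + R x (A y))
    (hS2 : ∀ A ∈ g, ∀ x y : V, A (T x y) = T (A x) y + T x (A y))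
    (A : ↥g) (x : V) :
    adJV g hg R hR T (A.1 x) =
      adJ g hg R hR T (A, 0) * adJV g hg R hR T x -
        adJV g hg R hR T x * adJ g hg R hR T (A, 0) := by
  refine LinearMap.ext fun w => Prod.ext (Subtype.ext ?_) ?_
  · have h := hS1 A.1 A.2 x w.2
    rw [sub_eq_iff_eq_add] at h
    simp [adJ, brkJ, adJV, LinearMap.comp_neg, LinearMap.neg_comp, h]
  · have h := hS2 A.1 A.2 x w.2
    simp [adJ, brkJ, adJV, h]
    abel

end

/-- For an irreducible generalized symmetric holonomy system, the restriction of
`B′` to `V` is a multiple of the inner product. -/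
theorem Bform_restrict_V_eq_smul_inner
    {V : Type} [NormedAddCommGroup V] [InnerProductSpace ℝ V]
    [FiniteDimensional ℝ V] [Nontrivial V]
    (g : Submodule ℝ (V →ₗ[ℝ] V))
    (hg_lie : ∀ A ∈ g, ∀ B ∈ g, A ∘ₗ B - B ∘ₗ A ∈ g)
    (hg_skew : ∀ A ∈ g, ∀ x y : V, ⟪A x, y⟫ = -⟪x, A y⟫)
    (R : V →ₗ[ℝ] V →ₗ[ℝ] (V →ₗ[ℝ] V)) (hRg : ∀ x y : V, R x y ∈ g)
    (hRalt : ∀ x : V, R x x = 0)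
    (T : V →ₗ[ℝ] V →ₗ[ℝ] V) (hTalt : ∀ x : V, T x x = 0)
    (hB1 : ∀ x y z : V,
      R x y z + T x (T y z) + R y z x + T y (T z x) + R z x y + T z (T x y) = 0)
    (hB2 : ∀ x y z : V, R x (T y z) + R y (T z x) + R z (T x y) = 0)
    (hS1 : ∀ A ∈ g, ∀ x y : V,
      A ∘ₗ R x y - R x y ∘ₗ A = R (A x) y + R x (A y))
    (hS2 : ∀ A ∈ g, ∀ x y : V, A (T x y) = T (A x) y + T x (A y))
    (hirr : ∀ W : Submodule ℝ V, (∀ A ∈ g, ∀ w ∈ W, A w ∈ W) → W = ⊥ ∨ W = ⊤) :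
    ∃ lam : ℝ, ∀ x y : V,
      Bform g hg_lie R hRg T ((0 : ↥g), x) ((0 : ↥g), y) = lam * ⟪x, y⟫ := by
  let b : V →ₗ[ℝ] V →ₗ[ℝ] ℝ :=
    (LinearMap.mul ℝ (Module.End ℝ (↥g × V))).compl₁₂
      (adJV g hg_lie R hRg T) (adJV g hg_lie R hRg T) |>.compr₂ (LinearMap.trace ℝ (↥g × V))
  refine exists_eq_smul_inner_of_invariant g hg_skew hirr b
    (fun x y => LinearMap.trace_mul_comm ℝ _ _) fun A hA x y => ?_
  have hx := adJV_apply_eq_commutator g hg_lie R hRg T hS1 hS2 ⟨A, hA⟩ x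
  have hy := adJV_apply_eq_commutator g hg_lie R hRg T hS1 hS2 ⟨A, hA⟩ y
  change LinearMap.trace ℝ _ (adJV g hg_lie R hRg T (A x) * adJV g hg_lie R hRg T y) =
    -LinearMap.trace ℝ _ (adJV g hg_lie R hRg T x * adJV g hg_lie R hRg T (A y))
  rw [hx, hy]
  exact trace_commutator_mul _ _ _
end

section
/- Let (V, R, T, 𝔤) be a generalized symmetric holonomy system. Then for every C ∈ 𝔤 and x ∈ V, B′(C,x) = Σᵢ ⟨T(x,eᵢ), C(eᵢ)⟩, where (eᵢ) is any orthonormal basis of V. -/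
open RealInnerProductSpace

/-- The trace of an endomorphism of a product is the sum of the traces of its diagonal blocks. -/
theorem LinearMap.trace_prod_eq_add {K M N : Type*} [Field K] [AddCommGroup M] [Module K M]
    [AddCommGroup N] [Module K N] [FiniteDimensional K M] [FiniteDimensional K N]
    (f : M × N →ₗ[K] M × N) :
    LinearMap.trace K (M × N) f =
      LinearMap.trace K M (LinearMap.fst K M N ∘ₗ f ∘ₗ LinearMap.inl K M N) +
        LinearMap.trace K N (LinearMap.snd K M N ∘ₗ f ∘ₗ LinearMap.inr K M N) := by
  rw [LinearMap.trace_comp_comm' (f ∘ₗ LinearMap.inl K M N),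
    LinearMap.trace_comp_comm' (f ∘ₗ LinearMap.inr K M N), LinearMap.comp_assoc,
    LinearMap.comp_assoc, ← map_add, ← LinearMap.comp_add]
  congr 1
  ext x <;> simp

/-- For a generalized symmetric holonomy system, for `C ∈ 𝔤` and `x ∈ V`,
`B′(C,x) = Σᵢ ⟨T(x,eᵢ), C(eᵢ)⟩` for any orthonormal basis `(eᵢ)` of `V`. -/
theorem Bform_g_V_eq_sum_inner_torsion
    {V : Type} [NormedAddCommGroup V] [InnerProductSpace ℝ V]
    [FiniteDimensional ℝ V] [Nontrivial V]
    (g : Submodule ℝ (V →ₗ[ℝ] V))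
    (hg_lie : ∀ A ∈ g, ∀ B ∈ g, A ∘ₗ B - B ∘ₗ A ∈ g)
    (hg_skew : ∀ A ∈ g, ∀ x y : V, ⟪A x, y⟫ = -⟪x, A y⟫)
    (R : V →ₗ[ℝ] V →ₗ[ℝ] (V →ₗ[ℝ] V)) (hRg : ∀ x y : V, R x y ∈ g)
    (hRalt : ∀ x : V, R x x = 0)
    (T : V →ₗ[ℝ] V →ₗ[ℝ] V) (hTalt : ∀ x : V, T x x = 0)
    (hB1 : ∀ x y z : V,
      R x y z + T x (T y z) + R y z x + T y (T z x) + R z x y + T z (T x y) = 0)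
    (hB2 : ∀ x y z : V, R x (T y z) + R y (T z x) + R z (T x y) = 0)
    (hS1 : ∀ A ∈ g, ∀ x y : V,
      A ∘ₗ R x y - R x y ∘ₗ A = R (A x) y + R x (A y))
    (hS2 : ∀ A ∈ g, ∀ x y : V, A (T x y) = T (A x) y + T x (A y)) :
    ∀ (C : ↥g) (x : V) (ι : Type) (_ : Fintype ι) (e : OrthonormalBasis ι ℝ V),
      Bform g hg_lie R hRg T (C, 0) ((0 : ↥g), x) = ∑ i, ⟪T x (e i), C.1 (e i)⟫ := by
  intro C x ι _ e
  have hfst : LinearMap.fst ℝ ↥g V ∘ₗ (adJ g hg_lie R hRg T (C, 0) ∘ₗ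
      adJ g hg_lie R hRg T ((0 : ↥g), x)) ∘ₗ LinearMap.inl ℝ ↥g V = 0 := by
    ext A v
    simp [adJ, brkJ]
  rw [Bform, LinearMap.trace_prod_eq_add, hfst, map_zero, zero_add,
    LinearMap.trace_eq_sum_inner _ e]
  refine Finset.sum_congr rfl fun i _ => ?_
  rw [real_inner_comm (C.1 (e i)), hg_skew C.1 C.2]
  simp [adJ, brkJ]
end

section
/- Let (V, R, T, 𝔤) be a generalized symmetric holonomy system. Assume that every element of 𝔤 lies in the linear span of { R(x,y) : x, y ∈ V } and that (R(a,b))(T(c,d)) = 0 for all a, b, c, d ∈ V. Then B′(C,x) = 0 for every C ∈ 𝔤 and every x ∈ V. -/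
open RealInnerProductSpace

/-- An endomorphism of a product whose two diagonal blocks vanish has trace zero. -/
theorem LinearMap.trace_eq_zero_of_diagonal_blocks_eq_zero {K M N : Type*} [Field K]
    [AddCommGroup M] [Module K M] [AddCommGroup N] [Module K N]
    [FiniteDimensional K M] [FiniteDimensional K N] (f : (M × N) →ₗ[K] (M × N))
    (h₁ : ∀ m : M, (f (m, 0)).1 = 0) (h₂ : ∀ n : N, (f (0, n)).2 = 0) :
    LinearMap.trace K (M × N) f = 0 := by
  have hf : f = f ∘ₗ LinearMap.inl K M N ∘ₗ LinearMap.fst K M N +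
      f ∘ₗ LinearMap.inr K M N ∘ₗ LinearMap.snd K M N := by
    refine LinearMap.ext fun p => ?_
    simp [← map_add]
  have hM : LinearMap.fst K M N ∘ₗ f ∘ₗ LinearMap.inl K M N = 0 := by
    ext m; simpa using h₁ m
  have hN : LinearMap.snd K M N ∘ₗ f ∘ₗ LinearMap.inr K M N = 0 := by
    ext n; simpa using h₂ n
  rw [hf, map_add, ← LinearMap.comp_assoc, ← LinearMap.comp_assoc,
    LinearMap.trace_comp_comm' (LinearMap.fst K M N),
    LinearMap.trace_comp_comm' (LinearMap.snd K M N), hM, hN]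
  simp

/-- If `𝔤` is spanned by the curvature operators and the curvature kills the image of the
torsion, then `B′(C,x) = 0` for all `C ∈ 𝔤`, `x ∈ V`. -/
theorem Bform_g_V_eq_zero
    {V : Type} [NormedAddCommGroup V] [InnerProductSpace ℝ V]
    [FiniteDimensional ℝ V] [Nontrivial V]
    (g : Submodule ℝ (V →ₗ[ℝ] V))
    (hg_lie : ∀ A ∈ g, ∀ B ∈ g, A ∘ₗ B - B ∘ₗ A ∈ g)
    (hg_skew : ∀ A ∈ g, ∀ x y : V, ⟪A x, y⟫ = -⟪x, A y⟫)
    (R : V →ₗ[ℝ] V →ₗ[ℝ] (V →ₗ[ℝ] V)) (hRg : ∀ x y : V, R x y ∈ g)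
    (hRalt : ∀ x : V, R x x = 0)
    (T : V →ₗ[ℝ] V →ₗ[ℝ] V) (hTalt : ∀ x : V, T x x = 0)
    (hB1 : ∀ x y z : V,
      R x y z + T x (T y z) + R y z x + T y (T z x) + R z x y + T z (T x y) = 0)
    (hB2 : ∀ x y z : V, R x (T y z) + R y (T z x) + R z (T x y) = 0)
    (hS1 : ∀ A ∈ g, ∀ x y : V,
      A ∘ₗ R x y - R x y ∘ₗ A = R (A x) y + R x (A y))
    (hS2 : ∀ A ∈ g, ∀ x y : V, A (T x y) = T (A x) y + T x (A y))
    (hspan : ∀ A ∈ g, A ∈ Submodule.span ℝ {B : V →ₗ[ℝ] V | ∃ x y : V, B = R x y})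
    (hRT : ∀ a b c d : V, R a b (T c d) = 0) :
    ∀ (C : ↥g) (x : V), Bform g hg_lie R hRg T (C, 0) ((0 : ↥g), x) = 0 := by
  intro C x
  have hCT : ∀ c d : V, C.1 (T c d) = 0 := by
    intro c d
    have hle : Submodule.span ℝ {B : V →ₗ[ℝ] V | ∃ x y : V, B = R x y} ≤
        LinearMap.ker (LinearMap.applyₗ (R := ℝ) (M₂ := V) (T c d)) := by
      rw [Submodule.span_le]
      rintro _ ⟨a, b, rfl⟩
      exact hRT a b c d
    exact hle (hspan C.1 C.2)
  refine LinearMap.trace_eq_zero_of_diagonal_blocks_eq_zero _ (fun A => ?_) (fun y => ?_)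
  · exact Subtype.ext (by simp [adJ, brkJ])
  · simp [adJ, brkJ, hCT]
end

section
/- Let (V, R, T, 𝔤) be an irreducible generalized symmetric holonomy system such that R vanishes on the image of T, i.e. (R(a,b))(T(c,d)) = 0 and R(a, T(b,c)) = 0 for all a, b, c, d ∈ V, and such that for every x ∈ V the endomorphism y ↦ T(x,y) of V is skew-adjoint. If Ric(x,x) = 0 for all x ∈ V, then R = 0, i.e. R(x,y) = 0 for all x, y ∈ V. -/
open RealInnerProductSpace

/-- If `f` becomes skew-adjoint after embedding its domain into an inner product space,
then `f ∘ f` has nonpositive trace. -/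
theorem LinearMap.trace_comp_self_nonpos_of_skew {W E : Type*} [AddCommGroup W] [Module ℝ W]
    [FiniteDimensional ℝ W] [NormedAddCommGroup E] [InnerProductSpace ℝ E]
    (J : W →ₗ[ℝ] E) (hJ : Function.Injective J) (f : W →ₗ[ℝ] W)
    (hf : ∀ w w' : W, ⟪J (f w), J w'⟫ = -⟪J w, J (f w')⟫) :
    LinearMap.trace ℝ W (f ∘ₗ f) ≤ 0 := by
  let j := LinearEquiv.ofInjective J hJ
  rw [← LinearMap.trace_conj' (f ∘ₗ f) j,
    LinearMap.trace_eq_sum_inner _ (stdOrthonormalBasis ℝ (LinearMap.range J))]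
  refine Finset.sum_nonpos fun i _ => ?_
  obtain ⟨w, hw⟩ := j.surjective (stdOrthonormalBasis ℝ (LinearMap.range J) i)
  rw [← hw, LinearEquiv.conj_apply_apply, LinearEquiv.symm_apply_apply]
  have h := hf w (f w)
  have h' : ⟪j w, j ((f ∘ₗ f) w)⟫ = ⟪J w, J (f (f w))⟫ := rfl
  have := real_inner_self_nonneg (x := J (f w))
  linarith

/-- A skew-adjoint endomorphism whose square has nonnegative trace vanishes. -/
theorem LinearMap.eq_zero_of_skew_of_trace_comp_self_nonneg {V : Type*} [NormedAddCommGroup V]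
    [InnerProductSpace ℝ V] [FiniteDimensional ℝ V] (A : V →ₗ[ℝ] V)
    (hA : ∀ x y : V, ⟪A x, y⟫ = -⟪x, A y⟫)
    (h : 0 ≤ LinearMap.trace ℝ V (A ∘ₗ A)) : A = 0 := by
  let b := stdOrthonormalBasis ℝ V
  have hsq : ∀ i, ⟪b i, (A ∘ₗ A) (b i)⟫ = -⟪A (b i), A (b i)⟫ := fun i => by
    rw [hA, neg_neg, LinearMap.comp_apply]
  rw [LinearMap.trace_eq_sum_inner _ b, Finset.sum_congr rfl fun i _ => hsq i,
    Finset.sum_neg_distrib] at h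
  have h0 := (Finset.sum_eq_zero_iff_of_nonneg fun i _ =>
    real_inner_self_nonneg (x := A (b i))).1
    (le_antisymm (by linarith) (Finset.sum_nonneg fun i _ => real_inner_self_nonneg))
  refine b.toBasis.ext fun i => ?_
  simpa using h0 i (Finset.mem_univ i)

/-- A skew-adjoint endomorphism is traceless. -/
theorem LinearMap.trace_eq_zero_of_skew {V : Type*} [NormedAddCommGroup V]
    [InnerProductSpace ℝ V] [FiniteDimensional ℝ V] (A : V →ₗ[ℝ] V)
    (hA : ∀ x y : V, ⟪A x, y⟫ = -⟪x, A y⟫) : LinearMap.trace ℝ V A = 0 := by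
  rw [LinearMap.trace_eq_sum_inner _ (stdOrthonormalBasis ℝ V)]
  refine Finset.sum_eq_zero fun i _ => ?_
  have := hA (stdOrthonormalBasis ℝ V i) (stdOrthonormalBasis ℝ V i)
  rw [real_inner_comm] at this
  linarith

/-- Ricci-flat symmetric holonomy systems (without torsion) are flat. -/
theorem symmetric_holonomy_ricci_flat_implies_flat {V : Type*} [NormedAddCommGroup V]
    [InnerProductSpace ℝ V] [FiniteDimensional ℝ V]
    (g : Submodule ℝ (V →ₗ[ℝ] V))
    (hg_lie : ∀ A ∈ g, ∀ B ∈ g, A ∘ₗ B - B ∘ₗ A ∈ g)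
    (hg_skew : ∀ A ∈ g, ∀ x y : V, ⟪A x, y⟫ = -⟪x, A y⟫)
    (R : V →ₗ[ℝ] V →ₗ[ℝ] (V →ₗ[ℝ] V)) (hRg : ∀ x y : V, R x y ∈ g)
    (hRalt : ∀ x : V, R x x = 0)
    (hB : ∀ x y z : V, R x y z + R y z x + R z x y = 0)
    (hS : ∀ A ∈ g, ∀ x y : V,
      A ∘ₗ R x y - R x y ∘ₗ A = R (A x) y + R x (A y))
    (hRic : ∀ x : V, LinearMap.trace ℝ V (R.flip x |>.flip x) = 0) (x y : V) :
    R x y = 0 := by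
  have hanti : ∀ a b : V, R a b = -R b a := fun a b => by
    have h := hRalt (a + b)
    simp only [map_add, LinearMap.add_apply, hRalt, zero_add, add_zero] at h
    exact eq_neg_of_add_eq_zero_right h
  have hsymm : ∀ a b : V, LinearMap.trace ℝ V (R.flip a |>.flip b) =
      LinearMap.trace ℝ V (R.flip b |>.flip a) := fun a b => by
    have h : (R.flip a |>.flip b) = (R.flip b |>.flip a) - R a b := by
      ext v
      have := hB a b v
      rw [hanti b v] at this
      simp only [LinearMap.flip_apply, LinearMap.sub_apply, LinearMap.neg_apply] at this ⊢
      rw [← sub_eq_zero, ← this]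
      abel
    rw [h, map_sub, LinearMap.trace_eq_zero_of_skew _ (hg_skew _ (hRg a b)), sub_zero]
  have hRic' : ∀ a b : V, LinearMap.trace ℝ V (R.flip a |>.flip b) = 0 := fun a b => by
    have h := hRic (a + b)
    have hadd : (R.flip (a + b) |>.flip (a + b)) = (R.flip a |>.flip a) + (R.flip a |>.flip b) +
        ((R.flip b |>.flip a) + (R.flip b |>.flip b)) := by
      ext v
      simp only [LinearMap.flip_apply, LinearMap.add_apply, map_add]
      abel
    rw [hadd, map_add, map_add, map_add, hRic, hRic] at h
    have := hsymm a b
    linarith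
  let A : V →ₗ[ℝ] V := R x y
  have hA : A ∈ g := hRg x y
  let φ : V → V →ₗ[ℝ] g := fun u => (R u).codRestrict g (hRg u)
  let ψ : V → g →ₗ[ℝ] V := fun u => (LinearMap.applyₗ u) ∘ₗ g.subtype
  let adA : g →ₗ[ℝ] g :=
    ((LinearMap.mulLeft ℝ A - LinearMap.mulRight ℝ A : Module.End ℝ (Module.End ℝ V)) ∘ₗ
      g.subtype).codRestrict g fun B => hg_lie A hA B B.2
  have had : ∀ (B : g) (v : V), (adA B : V →ₗ[ℝ] V) v = A ((B : V →ₗ[ℝ] V) v)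
      - (B : V →ₗ[ℝ] V) (A v) := fun B v => rfl
  have hadA : adA = φ y ∘ₗ ψ x - φ x ∘ₗ ψ y := by
    ext B v
    have h := LinearMap.congr_fun (hS B B.2 x y) v
    rw [hanti ((B : V →ₗ[ℝ] V) x) y] at h
    have h2 : ((φ y ∘ₗ ψ x - φ x ∘ₗ ψ y) B : V →ₗ[ℝ] V) v =
      R y ((B : V →ₗ[ℝ] V) x) v - R x ((B : V →ₗ[ℝ] V) y) v := rfl
    rw [had, h2]
    simp only [LinearMap.sub_apply, LinearMap.add_apply, LinearMap.neg_apply,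
      LinearMap.comp_apply] at h
    have h3 := congrArg Neg.neg h
    simp only [neg_sub, neg_add, neg_neg] at h3
    rw [h3, sub_eq_add_neg]
  have htr : LinearMap.trace ℝ g (adA ∘ₗ adA) = -LinearMap.trace ℝ V (A ∘ₗ A) := by
    have h1 : adA ∘ₗ adA = (adA ∘ₗ φ y) ∘ₗ ψ x - (adA ∘ₗ φ x) ∘ₗ ψ y := by
      refine (congrArg (adA ∘ₗ ·) hadA).trans ?_
      simp only [LinearMap.comp_sub, LinearMap.comp_assoc, LinearMap.comp_assoc]
    have h2 : ψ x ∘ₗ (adA ∘ₗ φ y) - ψ y ∘ₗ (adA ∘ₗ φ x) =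
        -(A ∘ₗ A) + (R.flip y |>.flip (A x)) - (R.flip x |>.flip (A y)) := by
      ext v
      change (A (R y v x) - R y v (A x)) - (A (R x v y) - R x v (A y)) =
        -(A (A v)) + R v y (A x) - R v x (A y)
      have h := congrArg A (hB x y v)
      rw [hanti v x] at h
      rw [hanti v x, hanti v y]
      simp only [map_add, map_zero, LinearMap.neg_apply, map_neg] at h ⊢
      change A (A v) + _ + _ = 0 at h
      rw [← sub_eq_zero, ← h]
      abel
    have h3 := map_sub (LinearMap.trace ℝ g) ((adA ∘ₗ φ y) ∘ₗ ψ x) ((adA ∘ₗ φ x) ∘ₗ ψ y)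
    refine (congrArg (LinearMap.trace ℝ g) h1).trans (h3.trans ?_)
    rw [LinearMap.trace_comp_comm', LinearMap.trace_comp_comm' (ψ y),
      ← map_sub, h2]
    simp only [map_sub, map_add, map_neg, hRic', add_zero, sub_zero]
  refine LinearMap.eq_zero_of_skew_of_trace_comp_self_nonneg A (hg_skew A hA) ?_
  let b := stdOrthonormalBasis ℝ V
  let J : g →ₗ[ℝ] PiLp 2 (fun _ : Fin (Module.finrank ℝ V) => V) :=
    (WithLp.linearEquiv 2 ℝ (Fin (Module.finrank ℝ V) → V)).symm.toLinearMap ∘ₗ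
      LinearMap.pi fun i => ψ (b i)
  have hJ : ∀ B C : g, ⟪J B, J C⟫ = -LinearMap.trace ℝ V ((B : V →ₗ[ℝ] V) ∘ₗ C) := fun B C => by
    rw [LinearMap.trace_eq_sum_inner _ b, PiLp.inner_apply, ← Finset.sum_neg_distrib]
    exact Finset.sum_congr rfl fun i _ => hg_skew B B.2 (b i) ((C : V →ₗ[ℝ] V) (b i))
  have hJinj : Function.Injective J := by
    refine (injective_iff_map_eq_zero J).2 fun B hB0 => Subtype.ext ?_
    refine b.toBasis.ext fun i => ?_
    rw [b.coe_toBasis]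
    exact congrArg (fun w : PiLp 2 (fun _ : Fin (Module.finrank ℝ V) => V) => w i) hB0
  have hnonpos := LinearMap.trace_comp_self_nonpos_of_skew J hJinj adA fun B C => by
    rw [hJ, hJ, neg_neg, neg_eq_iff_add_eq_zero, ← map_add]
    have h : (adA B : V →ₗ[ℝ] V) ∘ₗ (C : V →ₗ[ℝ] V) + (B : V →ₗ[ℝ] V) ∘ₗ (adA C : V →ₗ[ℝ] V) =
        A ∘ₗ ((B : V →ₗ[ℝ] V) ∘ₗ C) - ((B : V →ₗ[ℝ] V) ∘ₗ C) ∘ₗ A := by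
      ext v
      simp only [LinearMap.add_apply, LinearMap.sub_apply, LinearMap.comp_apply, had, map_sub]
      abel
    rw [h, map_sub, LinearMap.trace_comp_comm', sub_self]
  linarith

/-- Theorem on generalized symmetric holonomy systems (Theorem 5.3(i) of the paper):
if the system is irreducible, the curvature vanishes on the image of the torsion, and
`T(x,·)` is skew-adjoint for every `x`, then Ricci flatness implies flatness. -/
theorem gen_sym_holonomy_ricci_flat_implies_flat
    {V : Type} [NormedAddCommGroup V] [InnerProductSpace ℝ V]
    [FiniteDimensional ℝ V] [Nontrivial V]
    (g : Submodule ℝ (V →ₗ[ℝ] V))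
    (hg_lie : ∀ A ∈ g, ∀ B ∈ g, A ∘ₗ B - B ∘ₗ A ∈ g)
    (hg_skew : ∀ A ∈ g, ∀ x y : V, ⟪A x, y⟫ = -⟪x, A y⟫)
    (R : V →ₗ[ℝ] V →ₗ[ℝ] (V →ₗ[ℝ] V)) (hRg : ∀ x y : V, R x y ∈ g)
    (hRalt : ∀ x : V, R x x = 0)
    (T : V →ₗ[ℝ] V →ₗ[ℝ] V) (hTalt : ∀ x : V, T x x = 0)
    (hB1 : ∀ x y z : V,
      R x y z + T x (T y z) + R y z x + T y (T z x) + R z x y + T z (T x y) = 0)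
    (hB2 : ∀ x y z : V, R x (T y z) + R y (T z x) + R z (T x y) = 0)
    (hS1 : ∀ A ∈ g, ∀ x y : V,
      A ∘ₗ R x y - R x y ∘ₗ A = R (A x) y + R x (A y))
    (hS2 : ∀ A ∈ g, ∀ x y : V, A (T x y) = T (A x) y + T x (A y))
    (hirr : ∀ W : Submodule ℝ V, (∀ A ∈ g, ∀ w ∈ W, A w ∈ W) → W = ⊥ ∨ W = ⊤)
    (hRT1 : ∀ a b c d : V, R a b (T c d) = 0)
    (hRT2 : ∀ a b c : V, R a (T b c) = 0)
    (hTskew : ∀ x y z : V, ⟪T x y, z⟫ = -⟪y, T x z⟫)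
    (ι : Type) [Fintype ι] (e : OrthonormalBasis ι ℝ V)
    (hRic : ∀ x : V, ∑ i, ⟪R (e i) x x, e i⟫ = 0) :
    ∀ x y : V, R x y = 0 := by
  have hTdichotomy := hirr (Submodule.span ℝ {v | ∃ a b, T a b = v}) fun A hA w hw => by
    induction hw using Submodule.span_induction with
    | mem w hw =>
      obtain ⟨a, b, rfl⟩ := hw
      rw [hS2 A hA]
      exact add_mem (Submodule.subset_span ⟨_, _, rfl⟩) (Submodule.subset_span ⟨_, _, rfl⟩)
    | zero => rw [map_zero]; exact zero_mem _
    | add u v _ _ hu hv => rw [map_add]; exact add_mem hu hv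
    | smul c u _ hu => rw [map_smul]; exact Submodule.smul_mem _ c hu
  intro x y
  rcases hTdichotomy with h | h
  · have hT : ∀ a b, T a b = 0 := fun a b => by
      have hmem : T a b ∈ Submodule.span ℝ {v | ∃ a b, T a b = v} :=
        Submodule.subset_span ⟨a, b, rfl⟩
      rwa [h, Submodule.mem_bot] at hmem
    refine symmetric_holonomy_ricci_flat_implies_flat g hg_lie hg_skew R hRg hRalt
      (fun a b c => ?_) hS1 (fun a => ?_) x y
    · simpa [hT] using hB1 a b c
    · rw [LinearMap.trace_eq_sum_inner _ e, ← hRic a]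
      exact Finset.sum_congr rfl fun i _ => real_inner_comm _ _
  · refine LinearMap.ext_on h ?_
    rintro _ ⟨a, b, rfl⟩
    exact hRT1 x y a b
end

section
/- Let (V, R, 𝔤) be an irreducible symmetric holonomy system. If Ric(x,x) = 0 for all x ∈ V, then R = 0, i.e. R(x,y) = 0 for all x, y ∈ V. -/
open RealInnerProductSpace

/-- The square of an endomorphism that is skew with respect to a positive definite symmetric
bilinear form has nonpositive trace. -/
theorem trace_comp_self_nonpos_of_skew_s6 {F : Type*} [AddCommGroup F] [Module ℝ F]
    [FiniteDimensional ℝ F] (b : F →ₗ[ℝ] F →ₗ[ℝ] ℝ) (hsymm : ∀ x y, b x y = b y x)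
    (hnonneg : ∀ x, 0 ≤ b x x) (hdef : ∀ x, b x x = 0 → x = 0)
    (T : F →ₗ[ℝ] F) (hT : ∀ x y, b (T x) y = -b x (T y)) :
    LinearMap.trace ℝ F (T ∘ₗ T) ≤ 0 := by
  let core : InnerProductSpace.Core ℝ F :=
    { inner := fun x y => b x y
      conj_inner_symm := fun x y => hsymm y x
      re_inner_nonneg := hnonneg
      add_left := fun x y z => by simp
      smul_left := fun x y r => by simp
      definite := hdef }
  let : NormedAddCommGroup F := core.toNormedAddCommGroup
  let : InnerProductSpace ℝ F := InnerProductSpace.ofCore core.toCore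
  rw [LinearMap.trace_eq_sum_inner _ (stdOrthonormalBasis ℝ F)]
  refine Finset.sum_nonpos fun i _ => ?_
  have h : ∀ x, b x (T (T x)) = -b (T x) (T x) := fun x => by rw [hT, neg_neg]
  exact (h _).trans_le (neg_nonpos.2 (hnonneg _))

/-- For a skew-adjoint endomorphism `A`, the trace of `A ∘ A` is minus the squared
Hilbert–Schmidt norm of `A`. -/
theorem trace_comp_self_eq_neg_sum {V ι : Type*} [NormedAddCommGroup V] [InnerProductSpace ℝ V]
    [Fintype ι] (e : OrthonormalBasis ι ℝ V) (A : V →ₗ[ℝ] V)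
    (hA : ∀ x y : V, ⟪A x, y⟫ = -⟪x, A y⟫) :
    LinearMap.trace ℝ V (A ∘ₗ A) = -∑ i, ‖A (e i)‖ ^ 2 := by
  rw [LinearMap.trace_eq_sum_inner _ e, ← Finset.sum_neg_distrib]
  refine Finset.sum_congr rfl fun i _ => ?_
  rw [← real_inner_self_eq_norm_sq, hA, neg_neg, LinearMap.comp_apply]

/-- A skew-adjoint endomorphism whose square has nonnegative trace vanishes. -/
theorem eq_zero_of_trace_comp_self_nonneg {V ι : Type*} [NormedAddCommGroup V]
    [InnerProductSpace ℝ V] [Fintype ι] (e : OrthonormalBasis ι ℝ V) (A : V →ₗ[ℝ] V)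
    (hA : ∀ x y : V, ⟪A x, y⟫ = -⟪x, A y⟫) (h : 0 ≤ LinearMap.trace ℝ V (A ∘ₗ A)) : A = 0 := by
  rw [trace_comp_self_eq_neg_sum e A hA, neg_nonneg] at h
  have h0 := (Finset.sum_eq_zero_iff_of_nonneg fun i _ => sq_nonneg ‖A (e i)‖).1
    (h.antisymm (Finset.sum_nonneg fun i _ => sq_nonneg ‖A (e i)‖))
  exact e.toBasis.ext fun i => by simpa using h0 i (Finset.mem_univ i)

section SubmoduleOfEndomorphisms

variable {K V : Type*} [Field K] [AddCommGroup V] [Module K V]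

/-- Evaluation at `x` on a space of endomorphisms. -/
def evalOn (g : Submodule K (V →ₗ[K] V)) (x : V) : g →ₗ[K] V :=
  LinearMap.applyₗ x ∘ₗ g.subtype

@[simp]
theorem evalOn_apply (g : Submodule K (V →ₗ[K] V)) (x : V) (B : g) :
    evalOn g x B = (B : V →ₗ[K] V) x := rfl

/-- The commutator with an element `A` of a commutator-closed space of endomorphisms. -/
def adOn (g : Submodule K (V →ₗ[K] V)) (hg : ∀ A ∈ g, ∀ B ∈ g, A ∘ₗ B - B ∘ₗ A ∈ g)
    (A : g) : g →ₗ[K] g :=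
  (LinearMap.mulLeft K (A : Module.End K V) - LinearMap.mulRight K (A : Module.End K V)).restrict
    (hg A A.2)

@[simp]
theorem coe_adOn_apply (g : Submodule K (V →ₗ[K] V))
    (hg : ∀ A ∈ g, ∀ B ∈ g, A ∘ₗ B - B ∘ₗ A ∈ g) (A B : g) :
    (adOn g hg A B : V →ₗ[K] V) = (A : V →ₗ[K] V) ∘ₗ (B : V →ₗ[K] V) -
      (B : V →ₗ[K] V) ∘ₗ (A : V →ₗ[K] V) := rfl

variable [FiniteDimensional K V]

/-- The Killing form of the Lie algebra `g ⊕ V` of a symmetric holonomy system, evaluated on a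
curvature operator, in terms of Ricci traces. -/
theorem trace_adOn_sq_add_trace_sq (g : Submodule K (V →ₗ[K] V))
    (hg : ∀ A ∈ g, ∀ B ∈ g, A ∘ₗ B - B ∘ₗ A ∈ g)
    (R : V →ₗ[K] V →ₗ[K] (V →ₗ[K] V)) (hRg : ∀ x y : V, R x y ∈ g)
    (hRalt : ∀ x : V, R x x = 0)
    (hB1 : ∀ x y z : V, R x y z + R y z x + R z x y = 0)
    (hS1 : ∀ A ∈ g, ∀ x y : V, A ∘ₗ R x y - R x y ∘ₗ A = R (A x) y + R x (A y))
    (x y : V) :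
    LinearMap.trace K g (adOn g hg ⟨R x y, hRg x y⟩ ∘ₗ adOn g hg ⟨R x y, hRg x y⟩) +
        LinearMap.trace K V (R x y ∘ₗ R x y) =
      LinearMap.trace K V ((R x).flip (R x y y)) - LinearMap.trace K V ((R y).flip (R x y x)) := by
  have hRanti : ∀ u v, R u v = -R v u := fun u v => (LinearMap.IsAlt.neg hRalt v u).symm
  let P : V → V →ₗ[K] g := fun z => (R z).codRestrict g (hRg z)
  have hP : ∀ z v, (P z v : V →ₗ[K] V) = R z v := fun _ _ => rfl
  set D := adOn g hg ⟨R x y, hRg x y⟩ with hD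
  have hD_eq : D = P y ∘ₗ evalOn g x - P x ∘ₗ evalOn g y := by
    ext1 B
    apply Subtype.ext
    have h := hS1 B B.2 x y
    rw [hRanti (B.1 x) y] at h
    simp only [hD, coe_adOn_apply, LinearMap.sub_apply, LinearMap.comp_apply, evalOn_apply,
      AddSubgroupClass.coe_sub, hP]
    rw [← neg_sub, h]
    abel
  have hA_eq : R x y = evalOn g y ∘ₗ P x - evalOn g x ∘ₗ P y := by
    ext v
    have h := hB1 x y v
    rw [hRanti v x, LinearMap.neg_apply] at h
    simp only [LinearMap.sub_apply, LinearMap.comp_apply, evalOn_apply, hP]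
    exact sub_eq_zero.1 (by rw [← h]; abel)
  have hcomm : ∀ z, evalOn g z ∘ₗ D = R x y ∘ₗ evalOn g z - evalOn g (R x y z) := fun z => by
    ext B
    simp [hD]
  have hflip : ∀ z w, evalOn g w ∘ₗ P z = (R z).flip w := fun _ _ => rfl
  have key : ∀ z w, LinearMap.trace K g (D ∘ₗ P w ∘ₗ evalOn g z) =
      LinearMap.trace K V (R x y ∘ₗ evalOn g z ∘ₗ P w) -
        LinearMap.trace K V ((R w).flip (R x y z)) := fun z w => by
    rw [← LinearMap.comp_assoc, LinearMap.trace_comp_comm', ← LinearMap.comp_assoc, hcomm,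
      LinearMap.sub_comp, map_sub, hflip, LinearMap.comp_assoc]
  have h1 : LinearMap.trace K g (D ∘ₗ D) = LinearMap.trace K g (D ∘ₗ P y ∘ₗ evalOn g x) -
      LinearMap.trace K g (D ∘ₗ P x ∘ₗ evalOn g y) := by
    rw [← map_sub, ← LinearMap.comp_sub, ← hD_eq]
  have h2 : LinearMap.trace K V (R x y ∘ₗ R x y) =
      LinearMap.trace K V (R x y ∘ₗ evalOn g y ∘ₗ P x) -
        LinearMap.trace K V (R x y ∘ₗ evalOn g x ∘ₗ P y) := by
    rw [← map_sub, ← LinearMap.comp_sub, ← hA_eq]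
  rw [h1, h2, key, key]
  ring

end SubmoduleOfEndomorphisms

/-- On a commutator-closed space of skew-adjoint endomorphisms, the square of the commutator with
an element has nonpositive trace. -/
theorem trace_adOn_sq_nonpos {V : Type*} [NormedAddCommGroup V] [InnerProductSpace ℝ V]
    [FiniteDimensional ℝ V] (g : Submodule ℝ (V →ₗ[ℝ] V))
    (hg : ∀ A ∈ g, ∀ B ∈ g, A ∘ₗ B - B ∘ₗ A ∈ g)
    (hskew : ∀ A ∈ g, ∀ x y : V, ⟪A x, y⟫ = -⟪x, A y⟫) (A : g) :
    LinearMap.trace ℝ g (adOn g hg A ∘ₗ adOn g hg A) ≤ 0 := by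
  let e := stdOrthonormalBasis ℝ V
  let b : g →ₗ[ℝ] g →ₗ[ℝ] ℝ := LinearMap.mk₂ ℝ
    (fun B C => -LinearMap.trace ℝ V ((B : V →ₗ[ℝ] V) ∘ₗ (C : V →ₗ[ℝ] V)))
    (fun B B' C => by simp [LinearMap.add_comp, add_comm])
    (fun c B C => by simp [LinearMap.smul_comp])
    (fun B C C' => by simp [LinearMap.comp_add, add_comm])
    (fun c B C => by simp [LinearMap.comp_smul])
  have hb : ∀ B C, b B C = -LinearMap.trace ℝ V ((B : V →ₗ[ℝ] V) ∘ₗ (C : V →ₗ[ℝ] V)) :=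
    fun _ _ => rfl
  have hnonneg : ∀ B, 0 ≤ b B B := fun B => by
    rw [hb, trace_comp_self_eq_neg_sum e _ (hskew B B.2), neg_neg]
    positivity
  refine trace_comp_self_nonpos_of_skew_s6 b (fun B C => ?_) hnonneg (fun B h => ?_) _ fun B C => ?_
  · rw [hb, hb, LinearMap.trace_comp_comm']
  · exact Subtype.ext (eq_zero_of_trace_comp_self_nonneg e _ (hskew B B.2)
      (by rw [hb, neg_eq_zero] at h; exact h.ge))
  · rw [hb, hb, coe_adOn_apply, coe_adOn_apply, LinearMap.sub_comp, LinearMap.comp_sub, map_sub,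
      map_sub, LinearMap.comp_assoc, LinearMap.trace_comp_comm' (B.1 ∘ₗ C.1) A.1,
      LinearMap.comp_assoc, LinearMap.comp_assoc]
    ring

/-- If the Ricci curvature vanishes on the diagonal, then so do all Ricci traces. -/
theorem trace_flip_eq_zero_of_ricci_flat {V ι : Type*} [NormedAddCommGroup V]
    [InnerProductSpace ℝ V] [Fintype ι] (e : OrthonormalBasis ι ℝ V)
    (R : V →ₗ[ℝ] V →ₗ[ℝ] (V →ₗ[ℝ] V))
    (hskew : ∀ x y u v : V, ⟪R x y u, v⟫ = -⟪u, R x y v⟫)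
    (hRalt : ∀ x : V, R x x = 0)
    (hB1 : ∀ x y z : V, R x y z + R y z x + R z x y = 0)
    (hRic : ∀ x : V, ∑ i, ⟪R (e i) x x, e i⟫ = 0) (x z : V) :
    LinearMap.trace ℝ V ((R x).flip z) = 0 := by
  have hRanti : ∀ u v, R u v = -R v u := fun u v => (LinearMap.IsAlt.neg hRalt v u).symm
  have hdiag : ∀ w, LinearMap.trace ℝ V ((R w).flip w) = 0 := fun w => by
    rw [LinearMap.trace_eq_sum_inner _ e, ← neg_eq_zero, ← hRic w, ← Finset.sum_neg_distrib]
    refine Finset.sum_congr rfl fun i _ => ?_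
    rw [LinearMap.flip_apply, hRanti w, LinearMap.neg_apply, inner_neg_right, neg_neg,
      real_inner_comm]
  have htr : LinearMap.trace ℝ V (R x z) = 0 := by
    rw [LinearMap.trace_eq_sum_inner _ e]
    refine Finset.sum_eq_zero fun i _ => ?_
    have h := hskew x z (e i) (e i)
    rw [real_inner_comm] at h
    linarith
  have hsymm : LinearMap.trace ℝ V ((R x).flip z) = LinearMap.trace ℝ V ((R z).flip x) := by
    have h : (R x).flip z = R x z + (R z).flip x := by
      ext v
      have h := hB1 x z v
      rw [hRanti v x, LinearMap.neg_apply] at h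
      simp only [LinearMap.flip_apply, LinearMap.add_apply]
      exact (sub_eq_zero.1 (by rw [← h]; abel)).symm
    rw [h, map_add, htr, zero_add]
  have hpol := hdiag (x + z)
  have hexp : (R (x + z)).flip (x + z) =
      (R x).flip x + (R x).flip z + ((R z).flip x + (R z).flip z) := by
    ext v
    simp only [LinearMap.flip_apply, LinearMap.add_apply, map_add]
    abel
  rw [hexp, map_add, map_add, map_add, hdiag, hdiag] at hpol
  linarith

open RealInnerProductSpace

/-- Proposition 3.3 of the paper: an irreducible symmetric holonomy system with
vanishing Ricci curvature is flat. -/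
theorem sym_holonomy_ricci_flat_implies_flat
    {V : Type} [NormedAddCommGroup V] [InnerProductSpace ℝ V]
    [FiniteDimensional ℝ V] [Nontrivial V]
    (g : Submodule ℝ (V →ₗ[ℝ] V))
    (hg_lie : ∀ A ∈ g, ∀ B ∈ g, A ∘ₗ B - B ∘ₗ A ∈ g)
    (hg_skew : ∀ A ∈ g, ∀ x y : V, ⟪A x, y⟫ = -⟪x, A y⟫)
    (R : V →ₗ[ℝ] V →ₗ[ℝ] (V →ₗ[ℝ] V)) (hRg : ∀ x y : V, R x y ∈ g)
    (hRalt : ∀ x : V, R x x = 0)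
    (hB1 : ∀ x y z : V, R x y z + R y z x + R z x y = 0)
    (hS1 : ∀ A ∈ g, ∀ x y : V,
      A ∘ₗ R x y - R x y ∘ₗ A = R (A x) y + R x (A y))
    (hirr : ∀ W : Submodule ℝ V, (∀ A ∈ g, ∀ w ∈ W, A w ∈ W) → W = ⊥ ∨ W = ⊤)
    (ι : Type) [Fintype ι] (e : OrthonormalBasis ι ℝ V)
    (hRic : ∀ x : V, ∑ i, ⟪R (e i) x x, e i⟫ = 0) :
    ∀ x y : V, R x y = 0 := by
  intro x y
  have htrace := trace_adOn_sq_add_trace_sq g hg_lie R hRg hRalt hB1 hS1 x y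
  have hric := trace_flip_eq_zero_of_ricci_flat e R (fun x y => hg_skew _ (hRg x y)) hRalt hB1 hRic
  rw [hric, hric, sub_zero] at htrace
  have hnonpos := trace_adOn_sq_nonpos g hg_lie hg_skew ⟨R x y, hRg x y⟩
  exact eq_zero_of_trace_comp_self_nonneg e _ (hg_skew _ (hRg x y)) (by linarith)
end

section
/- Suppose (b_i + b_k − b_j)·T^j_{ik} = 0 for all indices i, j, k ∈ {1, …, n}. Then there exists an index j with b_j = 0. In particular the Hermitian matrix B with entries B_{ij} = Σ_{r,s} T^j_{rs}·conj(T^i_{rs}) is not positive definite. -/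
open scoped ComplexOrder

/-- If `(b_i + b_k − b_j)·T^j_{ik} = 0` for all `i,j,k`, where
`b_j = Σ_{r,s} |T^j_{rs}|²`, then some `b_j` vanishes; in particular the matrix
`B_{ij} = Σ_{r,s} T^j_{rs}·conj(T^i_{rs})` is not positive definite. -/
theorem exists_bj_zero_of_torsion_relation
    (n : ℕ) (hn : 1 ≤ n) (T : Fin n → Fin n → Fin n → ℂ)
    (hanti : ∀ i j k : Fin n, T j i k = -T j k i)
    (b : Fin n → ℝ) (hb : ∀ j, b j = ∑ r, ∑ s, ‖T j r s‖ ^ 2)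
    (h : ∀ i j k : Fin n, ((b i + b k - b j : ℝ) : ℂ) * T j i k = 0) :
    (∃ j, b j = 0) ∧
      ¬ (Matrix.of fun i j : Fin n => ∑ r, ∑ s, T j r s * star (T i r s)).PosDef := by
  have hzero : ∃ j, b j = 0 := by
    have : Nonempty (Fin n) := ⟨⟨0, hn⟩⟩
    obtain ⟨j, hj⟩ := Finite.exists_min b
    refine ⟨j, ?_⟩
    by_contra hne
    have hpos : 0 < b j := by
      refine lt_of_le_of_ne ?_ (Ne.symm hne)
      rw [hb]
      positivity
    obtain ⟨r, s, hrs⟩ : ∃ r s, T j r s ≠ 0 := by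
      by_contra! hT
      exact hne (by simp [hb, hT])
    have hsum : b r + b s - b j = 0 := by
      exact_mod_cast (mul_eq_zero.mp (h r j s)).resolve_right hrs
    linarith [hj r, hj s]
  refine ⟨hzero, fun hB => ?_⟩
  obtain ⟨j, hj⟩ := hzero
  have hdiag : ∑ r, ∑ s, T j r s * star (T j r s) = (b j : ℂ) := by
    simp [hb, Complex.mul_conj']
  have hpos := hB.diag_pos (i := j)
  rw [Matrix.of_apply, hdiag, hj] at hpos
  simp at hpos
end

section
/- Let α be a real number with α > 2. Suppose (b_i + b_k − α·b_j)·T^j_{ik} = 0 for all indices i, j, k ∈ {1, …, n}. Then T^j_{ik} = 0 for all i, j, k. -/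
/-- A single squared entry is bounded by the sum of all squared entries. -/
theorem sq_norm_le_sum_sum_sq_norm {ι κ E : Type*} [Fintype ι] [Fintype κ]
    [SeminormedAddCommGroup E] (f : ι → κ → E) (i : ι) (k : κ) :
    ‖f i k‖ ^ 2 ≤ ∑ r, ∑ s, ‖f r s‖ ^ 2 :=
  (Finset.single_le_sum (f := fun s => ‖f i s‖ ^ 2) (fun _ _ => by positivity)
    (Finset.mem_univ k)).trans
  (Finset.single_le_sum (f := fun r => ∑ s, ‖f r s‖ ^ 2) (fun _ _ => by positivity)
    (Finset.mem_univ i))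

/-- If `α > 2` and `(b_i + b_k − α·b_j)·T^j_{ik} = 0` for all `i,j,k`, where
`b_j = Σ_{r,s} |T^j_{rs}|²`, then `T = 0`. -/
theorem torsion_vanishes_of_relation_alpha_gt_two
    (n : ℕ) (hn : 1 ≤ n) (T : Fin n → Fin n → Fin n → ℂ)
    (hanti : ∀ i j k : Fin n, T j i k = -T j k i)
    (b : Fin n → ℝ) (hb : ∀ j, b j = ∑ r, ∑ s, ‖T j r s‖ ^ 2)
    (α : ℝ) (hα : 2 < α)
    (h : ∀ i j k : Fin n, ((b i + b k - α * b j : ℝ) : ℂ) * T j i k = 0) :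
    ∀ i j k : Fin n, T j i k = 0 := by
  have hle (j i k : Fin n) : ‖T j i k‖ ^ 2 ≤ b j :=
    hb j ▸ sq_norm_le_sum_sum_sq_norm (T j) i k
  have : Nonempty (Fin n) := ⟨⟨0, hn⟩⟩
  obtain ⟨m, hm⟩ := Finite.exists_max b
  have hbm : b m ≤ 0 := by
    by_contra! hpos
    have hzero (i k : Fin n) : T m i k = 0 := by
      refine (mul_eq_zero.mp (h i m k)).resolve_left fun hc => ?_
      have hc' : b i + b k - α * b m = 0 := by exact_mod_cast hc
      nlinarith [hm i, hm k, mul_pos (sub_pos.mpr hα) hpos]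
    simp [hb m, hzero] at hpos
  intro i j k
  have hsq : ‖T j i k‖ ^ 2 ≤ 0 := (hle j i k).trans ((hm j).trans hbm)
  exact norm_eq_zero.mp (pow_eq_zero_iff two_ne_zero |>.mp (le_antisymm hsq (by positivity)))
end

section
/- Let α be a real number with α < 2. Suppose (b_i + b_k − α·b_j)·T^j_{ik} = 0 for all indices i, j, k ∈ {1, …, n}. Then there exists an index j with b_j = 0. -/
/-- If `α < 2` and `(b_i + b_k − α·b_j)·T^j_{ik} = 0` for all `i,j,k`, where
`b_j = Σ_{r,s} |T^j_{rs}|²`, then some `b_j` vanishes. -/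
theorem exists_bj_zero_of_relation_alpha_lt_two
    (n : ℕ) (hn : 1 ≤ n) (T : Fin n → Fin n → Fin n → ℂ)
    (hanti : ∀ i j k : Fin n, T j i k = -T j k i)
    (b : Fin n → ℝ) (hb : ∀ j, b j = ∑ r, ∑ s, ‖T j r s‖ ^ 2)
    (α : ℝ) (hα : α < 2)
    (h : ∀ i j k : Fin n, ((b i + b k - α * b j : ℝ) : ℂ) * T j i k = 0) :
    ∃ j, b j = 0 := by
  have : Nonempty (Fin n) := ⟨⟨0, hn⟩⟩
  obtain ⟨j, hj⟩ := Finite.exists_min b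
  refine ⟨j, ?_⟩
  by_contra hne
  have hpos : 0 < b j := lt_of_le_of_ne (by rw [hb]; positivity) (Ne.symm hne)
  have hT : ∃ i k, T j i k ≠ 0 := by
    by_contra! hzero
    exact hne (by simp [hb, hzero])
  obtain ⟨i, k, hik⟩ := hT
  have hrel : b i + b k - α * b j = 0 := by
    exact_mod_cast (mul_eq_zero.mp (h i j k)).resolve_right hik
  nlinarith [hj i, hj k, mul_pos (sub_pos.mpr hα) hpos]
end
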